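/- Let G be a skew-symmetric endomorphism of Minkowski space 𝕄^{1,d-1} with rank G = 2. Then there exist nonzero vectors e, v ∈ ℝ^d with η(e,v) = 0 and η(v,v) > 0 such that G(w) = η(v,w)·e - η(e,w)·v for all w ∈ ℝ^d. -/

import Mathlib

open scoped BigOperators

/-- The Minkowski bilinear form on `ℝ^d`. -/
noncomputable def mink (d : ℕ) (x y : Fin d → ℝ) : ℝ :=
  ∑ i : Fin d, (if (i : ℕ) = 0 then (-1 : ℝ) else 1) * x i * y i

/-- Skew-symmetry w.r.t. the Minkowski form. -/
def IsSkew (d : ℕ) (F : (Fin d → ℝ) →ₗ[ℝ] (Fin d → ℝ)) : Prop :=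
  ∀ x y, mink d (F x) y = - mink d x (F y)

theorem mink_comm {d : ℕ} (x y : Fin d → ℝ) : mink d x y = mink d y x :=
  Finset.sum_congr rfl fun _ _ => by ring

theorem mink_add_left {d : ℕ} (x y z : Fin d → ℝ) :
    mink d (x + y) z = mink d x z + mink d y z := by
  simp only [mink, ← Finset.sum_add_distrib, Pi.add_apply]
  exact Finset.sum_congr rfl fun _ _ => by ring

theorem mink_smul_left {d : ℕ} (c : ℝ) (x z : Fin d → ℝ) :
    mink d (c • x) z = c * mink d x z := by
  simp only [mink, Finset.mul_sum, Pi.smul_apply, smul_eq_mul]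
  exact Finset.sum_congr rfl fun _ _ => by ring

theorem mink_sub_left {d : ℕ} (x y z : Fin d → ℝ) :
    mink d (x - y) z = mink d x z - mink d y z := by
  simp only [mink, ← Finset.sum_sub_distrib, Pi.sub_apply]
  exact Finset.sum_congr rfl fun _ _ => by ring

theorem mink_sub_right {d : ℕ} (x y z : Fin d → ℝ) :
    mink d z (x - y) = mink d z x - mink d z y := by
  rw [mink_comm, mink_sub_left, mink_comm x, mink_comm y]

theorem mink_smul_right {d : ℕ} (c : ℝ) (x z : Fin d → ℝ) :
    mink d z (c • x) = c * mink d z x := by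
  rw [mink_comm, mink_smul_left, mink_comm x]

/-- The Minkowski form is nondegenerate. -/
theorem exists_mink_ne_zero {d : ℕ} {x : Fin d → ℝ} (hx : x ≠ 0) : ∃ y, mink d x y ≠ 0 := by
  obtain ⟨i, hi⟩ := Function.ne_iff.mp hx
  refine ⟨Pi.single i 1, ?_⟩
  rw [mink, Finset.sum_eq_single i (fun j _ hj => by simp [hj]) (by simp)]
  have hi' : x i ≠ 0 := hi
  split_ifs <;> simpa using hi'

/-- A nonzero vector with vanishing time component is spacelike. -/
theorem mink_self_pos {d : ℕ} {v : Fin (d + 1) → ℝ} (hv : v ≠ 0) (h0 : v 0 = 0) :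
    0 < mink (d + 1) v v := by
  have key : mink (d + 1) v v = ∑ i, v i * v i := by
    refine Finset.sum_congr rfl fun i _ => ?_
    split_ifs with h
    · have hi : i = 0 := Fin.ext h
      simp [hi, h0]
    · ring
  obtain ⟨i, hi⟩ := Function.ne_iff.mp hv
  rw [key]
  exact Finset.sum_pos' (fun j _ => mul_self_nonneg _) ⟨i, Finset.mem_univ i, mul_self_pos.mpr hi⟩

/-- A skew-symmetric endomorphism whose values are all multiples of one vector vanishes. -/
theorem eq_zero_of_skew_of_forall_eq_smul {d : ℕ} {H : (Fin d → ℝ) → (Fin d → ℝ)}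
    (hH : ∀ x y, mink d (H x) y = - mink d x (H y)) {u : Fin d → ℝ} (hu : u ≠ 0)
    (h : ∀ w, ∃ c : ℝ, H w = c • u) (w : Fin d → ℝ) : H w = 0 := by
  choose c hc using h
  obtain ⟨y, hy⟩ := exists_mink_ne_zero hu
  have key : ∀ a b, c a * mink d u b = - (c b * mink d u a) := fun a b => by
    have := hH a b
    rwa [hc, hc, mink_smul_left, mink_smul_right, mink_comm a] at this
  have hcy : c y = 0 := by
    have : c y * mink d u y = 0 := by linarith [key y y]
    exact (mul_eq_zero.mp this).resolve_right hy
  have hcw : c w = 0 := by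
    have : c w * mink d u y = 0 := by rw [key, hcy]; ring
    exact (mul_eq_zero.mp this).resolve_right hy
  rw [hc, hcw, zero_smul]

/-- The vectors of a plane that are orthogonal to a vector `v` of the plane with `η(v,v) ≠ 0`
form a line. -/
theorem exists_orthogonal_generator {d : ℕ} {x y v : Fin d → ℝ}
    (hxy : ∀ s t : ℝ, s • x + t • y = 0 → s = 0 ∧ t = 0)
    (hv : ∃ s t : ℝ, v = s • x + t • y) (hvv : mink d v v ≠ 0) :
    ∃ u : Fin d → ℝ, u ≠ 0 ∧
      ∀ s t : ℝ, mink d (s • x + t • y) v = 0 → ∃ c : ℝ, s • x + t • y = c • u := by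
  obtain ⟨p, q, hpq⟩ := hv
  have hne : ¬(mink d x v = 0 ∧ mink d y v = 0) := fun ⟨hA, hB⟩ => hvv <| by
    have : mink d v v = mink d (p • x + q • y) v := by rw [← hpq]
    rw [this, mink_add_left, mink_smul_left, mink_smul_left, hA, hB]
    ring
  set A := mink d x v
  set B := mink d y v
  have hAB : A ^ 2 + B ^ 2 ≠ 0 := fun h => hne ⟨by nlinarith, by nlinarith⟩
  refine ⟨B • x + (-A) • y, fun h => ?_, fun s t hst => ?_⟩
  · obtain ⟨hB, hA⟩ := hxy _ _ h
    exact hne ⟨neg_eq_zero.mp hA, hB⟩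
  · rw [mink_add_left, mink_smul_left, mink_smul_left] at hst
    change s * A + t * B = 0 at hst
    refine ⟨(s * B - t * A) / (A ^ 2 + B ^ 2), ?_⟩
    rw [smul_add, smul_smul, smul_smul]
    congr 2
    · field_simp
      linear_combination A * hst
    · field_simp
      linear_combination B * hst

/-- Every simple (rank 2) skew-symmetric endomorphism of `𝕄^{1,d-1}` can be
written `G(w) = η(v,w)e - η(e,w)v` with `e, v` nonzero orthogonal and `v`
spacelike. -/
theorem stmt14 (d : ℕ)
    (G : (Fin d → ℝ) →ₗ[ℝ] (Fin d → ℝ)) (hG : IsSkew d G)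
    (hrank : Module.finrank ℝ (LinearMap.range G) = 2) :
    ∃ e v : Fin d → ℝ, e ≠ 0 ∧ v ≠ 0 ∧ mink d e v = 0 ∧ 0 < mink d v v ∧
      ∀ w : Fin d → ℝ, G w = mink d v w • e - mink d e w • v := by
  obtain _ | d := d
  · have := (LinearMap.range G).finrank_le
    simp [hrank] at this
  let b := Module.finBasisOfFinrankEq ℝ (LinearMap.range G) hrank
  obtain ⟨x, hx⟩ : ∃ x, x = (b 0 : Fin (d + 1) → ℝ) := ⟨_, rfl⟩
  obtain ⟨y, hy⟩ : ∃ y, y = (b 1 : Fin (d + 1) → ℝ) := ⟨_, rfl⟩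
  have hspan : ∀ r ∈ LinearMap.range G, ∃ s t : ℝ, r = s • x + t • y := fun r hr => by
    refine ⟨b.repr ⟨r, hr⟩ 0, b.repr ⟨r, hr⟩ 1, ?_⟩
    have := congrArg Subtype.val (b.sum_repr ⟨r, hr⟩)
    rw [Fin.sum_univ_two] at this
    rw [hx, hy]
    exact this.symm
  have hind : ∀ s t : ℝ, s • x + t • y = 0 → s = 0 ∧ t = 0 := fun s t h => by
    have hb := Fintype.linearIndependent_iff.mp b.linearIndependent ![s, t] (by
      ext1
      simpa [Fin.sum_univ_two, ← hx, ← hy] using h)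
    exact ⟨hb 0, hb 1⟩
  have hxr : x ∈ LinearMap.range G := hx ▸ (b 0).2
  have hyr : y ∈ LinearMap.range G := hy ▸ (b 1).2
  obtain ⟨v, hvr, hv, hv0⟩ : ∃ v ∈ LinearMap.range G, v ≠ 0 ∧ v 0 = 0 := by
    by_cases h : x 0 = 0
    · exact ⟨x, hxr, fun hx0 => one_ne_zero (hind 1 0 (by simp [hx0])).1, h⟩
    · refine ⟨(y 0) • x + (-x 0) • y,
        add_mem (Submodule.smul_mem _ _ hxr) (Submodule.smul_mem _ _ hyr), fun h0 => ?_, ?_⟩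
      · exact h (neg_eq_zero.mp (hind _ _ h0).2)
      · simp [mul_comm]
  have hvv : 0 < mink (d + 1) v v := mink_self_pos hv hv0
  obtain ⟨u, hu, hline⟩ := exists_orthogonal_generator hind (hspan v hvr) hvv.ne'
  have hGv : mink (d + 1) (G v) v = 0 := by
    have := hG v v
    rw [mink_comm v] at this
    linarith
  obtain ⟨e, he⟩ : ∃ e, e = (mink (d + 1) v v)⁻¹ • G v := ⟨_, rfl⟩
  have hev : mink (d + 1) e v = 0 := by rw [he, mink_smul_left, hGv, mul_zero]
  have hform : ∀ w, G w = mink (d + 1) v w • e - mink (d + 1) e w • v := fun w => by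
    refine sub_eq_zero.mp (eq_zero_of_skew_of_forall_eq_smul
      (H := fun w => G w - (mink (d + 1) v w • e - mink (d + 1) e w • v)) ?_ hu ?_ w)
    · intro a c
      simp only [mink_sub_left, mink_sub_right, mink_smul_left, mink_smul_right, hG a c,
        mink_comm a v, mink_comm a e]
      ring
    · intro w
      have her : e ∈ LinearMap.range G := he ▸ Submodule.smul_mem _ _ (LinearMap.mem_range_self G v)
      obtain ⟨s, t, hst⟩ := hspan (G w - (mink (d + 1) v w • e - mink (d + 1) e w • v))
        (sub_mem (LinearMap.mem_range_self G w)
          (sub_mem (Submodule.smul_mem _ _ her) (Submodule.smul_mem _ _ hvr)))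
      obtain ⟨c, hc⟩ := hline s t (by
        rw [← hst]
        simp only [mink_sub_left, mink_smul_left, hev, hG w v]
        rw [he, mink_smul_left, mink_comm w]
        field_simp
        ring)
      exact ⟨c, hst.trans hc⟩
  refine ⟨e, v, fun h0 => hv ?_, hv, hev, hvv, hform⟩
  obtain ⟨a, rfl⟩ := hvr
  rw [hform a, h0]
  simp [mink]
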